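/- arXiv:2504.07259 — 2 statements merged into one kernel-verified Lean document; each statement's English description precedes it below -/
import Mathlib

section
/- Let H be a real Hilbert space and f, g : H → ℝ two convex functions of class C¹ (continuously Fréchet differentiable). Assume (i) ‖∇f(x)‖ = ‖∇g(x)‖ for all x ∈ H; (ii) p_f = p_g, where p_f and p_g are the Crandall–Pazy directions of f and g; and (iii) there exists x̂ ∈ H with ∇f(x̂) = p_f. Then there exists a constant c ∈ ℝ such that f(x) = g(x) + c for all x ∈ H. -/
open Set Filter

open Topology

theorem Convex.sq_norm_le_inner_of_forall_norm_le {H : Type*} [NormedAddCommGroup H]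
    [InnerProductSpace ℝ H] {K : Set H} (hK : Convex ℝ K) {p : H}
    (hp : p ∈ K) (hmin : ∀ q ∈ K, ‖p‖ ≤ ‖q‖) {q : H} (hq : q ∈ K) : ‖p‖ ^ 2 ≤ inner ℝ p q := by
  have : Nonempty K := ⟨⟨p, hp⟩⟩
  have heq : ‖0 - p‖ = ⨅ w : K, ‖0 - (w : H)‖ := by
    refine le_antisymm (le_ciInf fun w => by simpa using hmin w w.2) ?_
    exact ciInf_le ⟨0, by rintro _ ⟨w, rfl⟩; positivity⟩ (⟨p, hp⟩ : K)
  have := (norm_eq_iInf_iff_real_inner_le_zero hK hp).1 heq q hq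
  rw [zero_sub, inner_neg_left, inner_sub_right, real_inner_self_eq_norm_sq] at this
  linarith

section

variable {H : Type*} [NormedAddCommGroup H] [InnerProductSpace ℝ H] [CompleteSpace H]
  {f g : H → ℝ}

theorem ConvexOn.add_inner_gradient_le (hf : ConvexOn ℝ univ f) (hd : Differentiable ℝ f)
    (x y : H) : f x + inner ℝ (gradient f x) (y - x) ≤ f y := by
  have hc : ConvexOn ℝ univ (fun t : ℝ => f (AffineMap.lineMap x y t)) :=
    hf.comp_affineMap (AffineMap.lineMap x y)
  have hx : HasFDerivAt f (InnerProductSpace.toDual ℝ H (gradient f x))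
      (AffineMap.lineMap x y (0 : ℝ)) := by
    simpa using (hd x).hasGradientAt.hasFDerivAt
  have hderiv : HasDerivAt (fun t : ℝ => f (AffineMap.lineMap x y t))
      (inner ℝ (gradient f x) (y - x)) 0 := by
    rw [← InnerProductSpace.toDual_apply_apply (𝕜 := ℝ)]
    exact hx.comp_hasDerivAt (0 : ℝ) AffineMap.hasDerivAt_lineMap
  have := hc.le_slope_of_hasDerivAt (mem_univ 0) (mem_univ 1) one_pos hderiv
  simp only [slope_def_field, AffineMap.lineMap_apply_one, AffineMap.lineMap_apply_zero,
    sub_zero, div_one] at this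
  linarith

theorem ConvexOn.inner_gradient_sub_nonneg (hf : ConvexOn ℝ univ f) (hd : Differentiable ℝ f)
    (x y : H) : 0 ≤ inner ℝ (gradient f x - gradient f y) (x - y) := by
  have h₁ := hf.add_inner_gradient_le hd x y
  have h₂ := hf.add_inner_gradient_le hd y x
  simp only [inner_sub_left, inner_sub_right] at *
  linarith

theorem gradient_eq_of_forall_le (hd : Differentiable ℝ f) {y p : H} {C : ℝ}
    (h : ∀ z, f y + inner ℝ p (z - y) - C * ‖z - y‖ ^ 2 ≤ f z) : gradient f y = p := by
  have hmin : IsLocalMin (fun z => f z - inner ℝ p (z - y) + C * ‖z - y‖ ^ 2) y :=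
    Eventually.of_forall fun z => by
      have := h z
      simp only [sub_self, inner_zero_right, norm_zero]
      linarith
  have hsub : HasFDerivAt (fun z : H => z - y) (ContinuousLinearMap.id ℝ H) y :=
    (hasFDerivAt_id y).sub_const y
  have hderiv := ((hd y).hasGradientAt.hasFDerivAt.sub
    ((innerSL ℝ p).hasFDerivAt.comp y hsub)).add (hsub.norm_sq.const_mul C)
  have hz := hmin.hasFDerivAt_eq_zero hderiv
  refine ext_inner_right ℝ fun v => ?_
  have := DFunLike.congr_fun hz v
  simp only [toDual_gradient, sub_self, map_zero, smul_zero,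
    add_zero, ContinuousLinearMap.comp_id, sub_apply, innerSL_apply_apply, zero_apply] at this
  rw [inner_gradient_left]
  linarith

theorem ConvexOn.exists_forall_add_sq_norm_le (hf : ConvexOn ℝ univ f) (hd : Differentiable ℝ f)
    {C : ℝ} (hC : 0 < C) (x : H) :
    ∃ y, ∀ z, f y + C * ‖y - x‖ ^ 2 ≤ f z + C * ‖z - x‖ ^ 2 := by
  set Φ : H → ℝ := fun z => f z + C * ‖z - x‖ ^ 2 with hΦ
  have hcont : Continuous Φ := by
    have := hd.continuous
    fun_prop
  have hbdd : BddBelow (range Φ) := by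
    refine ⟨f x - ‖gradient f x‖ ^ 2 / (4 * C), ?_⟩
    rintro _ ⟨z, rfl⟩
    have h₁ := hf.add_inner_gradient_le hd x z
    have h₂ := neg_le_of_abs_le (abs_real_inner_le_norm (gradient f x) (z - x))
    have h₃ : C * ‖z - x‖ ^ 2 - ‖gradient f x‖ * ‖z - x‖ + ‖gradient f x‖ ^ 2 / (4 * C)
        = C * (‖z - x‖ - ‖gradient f x‖ / (2 * C)) ^ 2 := by
      field_simp
      ring
    have h₄ : 0 ≤ C * (‖z - x‖ - ‖gradient f x‖ / (2 * C)) ^ 2 := by positivity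
    simp only [hΦ]
    linarith
  set m := iInf Φ
  have hm (z : H) : m ≤ Φ z := ciInf_le hbdd z
  have hmid (a b : H) : C / 4 * ‖a - b‖ ^ 2 ≤ (Φ a + Φ b) / 2 - m := by
    have h₁ := hf.2 (mem_univ a) (mem_univ b) (by norm_num : (0 : ℝ) ≤ 1 / 2)
      (by norm_num : (0 : ℝ) ≤ 1 / 2) (by norm_num)
    have h₂ := hm ((1 / 2 : ℝ) • a + (1 / 2 : ℝ) • b)
    have h₃ := parallelogram_law_with_norm ℝ (a - x) (b - x)
    have h₄ : (1 / 2 : ℝ) • a + (1 / 2 : ℝ) • b - x = (1 / 2 : ℝ) • ((a - x) + (b - x)) := by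
      module
    have h₅ : (a - x) - (b - x) = a - b := by abel
    simp only [hΦ, h₄, norm_smul, smul_eq_mul] at h₁ h₂ ⊢
    rw [h₅] at h₃
    norm_num at h₁ h₂
    linear_combination h₂ + h₁ + C / 4 * h₃
  have hex (n : ℕ) : ∃ z, Φ z < m + 1 / ((n : ℝ) + 1) :=
    exists_lt_of_ciInf_lt (lt_add_of_pos_right m (by positivity))
  choose u hu using hex
  have hcauchy : CauchySeq u := by
    refine cauchySeq_of_le_tendsto_0 (fun n : ℕ => √(4 / C * (1 / ((n : ℝ) + 1)))) ?_ ?_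
    · intro n k N hn hk
      rw [dist_eq_norm]
      apply Real.le_sqrt_of_sq_le
      have h₁ := hmid (u n) (u k)
      have h₂ := hu n
      have h₃ := hu k
      have h₄ : 1 / ((n : ℝ) + 1) ≤ 1 / ((N : ℝ) + 1) := Nat.one_div_le_one_div hn
      have h₅ : 1 / ((k : ℝ) + 1) ≤ 1 / ((N : ℝ) + 1) := Nat.one_div_le_one_div hk
      have h₆ : C / 4 * ‖u n - u k‖ ^ 2 ≤ 1 / ((N : ℝ) + 1) := by linarith
      calc ‖u n - u k‖ ^ 2 = 4 / C * (C / 4 * ‖u n - u k‖ ^ 2) := by field_simp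
        _ ≤ _ := by gcongr
    · have := (tendsto_one_div_add_atTop_nhds_zero_nat (𝕜 := ℝ)).const_mul (4 / C)
      simpa using this.sqrt
  obtain ⟨y, hy⟩ := cauchySeq_tendsto_of_complete hcauchy
  have hle : Φ y ≤ m := by
    refine le_of_tendsto_of_tendsto' ((hcont.tendsto y).comp hy) ?_ fun n => (hu n).le
    simpa using (tendsto_one_div_add_atTop_nhds_zero_nat (𝕜 := ℝ)).const_add m
  exact ⟨y, fun z => hle.trans (hm z)⟩

/-- The resolvent of the gradient of a differentiable convex function is defined everywhere. -/
theorem ConvexOn.exists_add_smul_gradient_eq (hf : ConvexOn ℝ univ f) (hd : Differentiable ℝ f)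
    {r : ℝ} (hr : 0 < r) (x : H) : ∃ y, y + r • gradient f y = x := by
  obtain ⟨y, hy⟩ := hf.exists_forall_add_sq_norm_le hd (C := 1 / (2 * r)) (by positivity) x
  refine ⟨y, ?_⟩
  have hgrad : gradient f y = (1 / r) • (x - y) := by
    refine gradient_eq_of_forall_le hd (C := 1 / (2 * r)) fun z => ?_
    have h₁ := hy z
    have h₂ : ‖z - x‖ ^ 2 = ‖z - y‖ ^ 2 - 2 * inner ℝ (x - y) (z - y) + ‖y - x‖ ^ 2 := by
      rw [← sub_sub_sub_cancel_right z x y, norm_sub_sq_real, norm_sub_rev x y, real_inner_comm]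
    rw [h₂] at h₁
    rw [real_inner_smul_left]
    have h₃ : 1 / r = 2 * (1 / (2 * r)) := by field_simp
    rw [h₃]
    linarith
  rw [hgrad, smul_smul, mul_one_div_cancel hr.ne', one_smul, add_sub_cancel]

theorem ConvexOn.mem_closure_range_gradient (hf : ConvexOn ℝ univ f) (hd : Differentiable ℝ f)
    {v : H} {m : ℝ} (hm : ∀ z, m ≤ f z - inner ℝ v z) :
    v ∈ closure (range (gradient f)) := by
  have hex (n : ℕ) : ∃ y, y + ((n : ℝ) + 1) • gradient f y = ((n : ℝ) + 1) • v :=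
    hf.exists_add_smul_gradient_eq hd (by positivity) _
  choose y hy using hex
  refine mem_closure_of_tendsto (f := fun n => gradient f (y n)) ?_
    (Eventually.of_forall fun n => mem_range_self _) (b := atTop)
  rw [tendsto_iff_norm_sub_tendsto_zero]
  have hlim : Tendsto (fun n : ℕ => √((f 0 - m) * (1 / ((n : ℝ) + 1)))) atTop (𝓝 0) := by
    have := (tendsto_one_div_add_atTop_nhds_zero_nat (𝕜 := ℝ)).const_mul (f 0 - m)
    simpa using this.sqrt
  refine squeeze_zero (fun n => norm_nonneg _) (fun n => Real.le_sqrt_of_sq_le ?_) hlim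
  have hpos : (0 : ℝ) < n + 1 := by positivity
  have h₁ := hf.add_inner_gradient_le hd (y n) 0
  have h₂ := hm (y n)
  have h₃ : y n = ((n : ℝ) + 1) • (v - gradient f (y n)) := by
    rw [smul_sub, ← hy n, add_sub_cancel_right]
  have h₄ : inner ℝ (v - gradient f (y n)) (y n)
      = ((n : ℝ) + 1) * ‖gradient f (y n) - v‖ ^ 2 := by
    calc inner ℝ (v - gradient f (y n)) (y n)
        = inner ℝ (v - gradient f (y n)) (((n : ℝ) + 1) • (v - gradient f (y n))) := by rw [← h₃]
      _ = _ := by rw [real_inner_smul_right, real_inner_self_eq_norm_sq, norm_sub_rev]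
  rw [inner_sub_left] at h₄
  rw [zero_sub, inner_neg_right] at h₁
  rw [mul_one_div, le_div_iff₀ hpos]
  linarith

theorem ConvexOn.convex_closure_range_gradient (hf : ConvexOn ℝ univ f)
    (hd : Differentiable ℝ f) : Convex ℝ (closure (range (gradient f))) := by
  intro u hu v hv a b ha hb hab
  rw [← closure_closure (s := range (gradient f))]
  refine map_mem_closure₂ (f := fun u v : H => a • u + b • v) (by fun_prop) hu hv ?_
  rintro _ ⟨x, rfl⟩ _ ⟨y, rfl⟩
  refine hf.mem_closure_range_gradient hd
    (m := a * (f x - inner ℝ (gradient f x) x) + b * (f y - inner ℝ (gradient f y) y)) fun z => ?_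
  have h₁ := mul_le_mul_of_nonneg_left (hf.add_inner_gradient_le hd x z) ha
  have h₂ := mul_le_mul_of_nonneg_left (hf.add_inner_gradient_le hd y z) hb
  have h₃ : f z = a * f z + b * f z := by rw [← add_mul, hab, one_mul]
  rw [inner_add_left, real_inner_smul_left, real_inner_smul_left, h₃]
  rw [inner_sub_right] at h₁ h₂
  linarith

theorem ConvexOn.gradient_sub_smul_eq (hf : ConvexOn ℝ univ f) (hd : Differentiable ℝ f)
    {p x : H} (hp : ∀ z, ‖p‖ ^ 2 ≤ inner ℝ p (gradient f z)) (hx : gradient f x = p)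
    {t : ℝ} (ht : 0 ≤ t) :
    gradient f (x - t • p) = p ∧ f (x - t • p) = f x - t * ‖p‖ ^ 2 := by
  have h₁ := hf.add_inner_gradient_le hd (x - t • p) x
  have h₂ := mul_le_mul_of_nonneg_left (hp (x - t • p)) ht
  rw [sub_sub_cancel, real_inner_smul_right, real_inner_comm] at h₁
  have h₃ (z : H) := hf.add_inner_gradient_le hd x z
  simp only [hx] at h₃
  have h₄ := h₃ (x - t • p)
  rw [sub_sub_cancel_left, inner_neg_right, real_inner_smul_right,
    real_inner_self_eq_norm_sq] at h₄
  refine ⟨gradient_eq_of_forall_le hd (C := 0) fun z => ?_, by linarith⟩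
  have h₅ := h₃ z
  have h₆ : z - (x - t • p) = (z - x) + t • p := by abel
  rw [h₆, inner_add_right, real_inner_smul_right, real_inner_self_eq_norm_sq]
  linarith

theorem tendsto_zero_of_sum_le {a b : ℕ → ℝ} {B : ℝ} (ha : ∀ n, 0 ≤ a n)
    (hab : ∀ n, a n ≤ b n - b (n + 1)) (hb : ∀ n, B ≤ b n) : Tendsto a atTop (𝓝 0) := by
  refine (summable_of_sum_range_le (c := b 0 - B) ha fun n => ?_).tendsto_atTop_zero
  calc ∑ i ∈ Finset.range n, a i ≤ ∑ i ∈ Finset.range n, (b i - b (i + 1)) :=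
        Finset.sum_le_sum fun i _ => hab i
    _ = b 0 - b n := Finset.sum_range_sub' b n
    _ ≤ b 0 - B := by linarith [hb n]

/-- Along a proximal sequence of `f`, the gradient norms tend to the minimal one. -/
theorem ConvexOn.tendsto_norm_gradient_prox (hf : ConvexOn ℝ univ f) (hd : Differentiable ℝ f)
    {p x : H} (hp : ∀ z, ‖p‖ ^ 2 ≤ inner ℝ p (gradient f z)) (hx : gradient f x = p)
    {r : ℝ} (hr : 0 < r) {u : ℕ → H} (hu : ∀ n, u (n + 1) + r • gradient f (u (n + 1)) = u n) :
    Tendsto (fun n => ‖gradient f (u n)‖) atTop (𝓝 ‖p‖) := by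
  have hnorm (z : H) : ‖p‖ ≤ ‖gradient f z‖ := by
    have h₁ := (hp z).trans (real_inner_le_norm _ _)
    by_contra! h₂
    nlinarith [norm_nonneg p, norm_nonneg (gradient f z)]
  have hsq : Tendsto (fun n => r * (‖gradient f (u (n + 1))‖ - ‖p‖) ^ 2) atTop (𝓝 0) := by
    refine tendsto_zero_of_sum_le (b := fun n => f (u n) - inner ℝ p (u n))
      (B := f x - inner ℝ p x) (fun n => by positivity) (fun n => ?_) fun n => ?_
    · have h₁ := hf.add_inner_gradient_le hd (u (n + 1)) (u n)
      have h₂ : u n = u (n + 1) + r • gradient f (u (n + 1)) := (hu n).symm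
      have h₃ : inner ℝ p (u n)
          = inner ℝ p (u (n + 1)) + r * inner ℝ p (gradient f (u (n + 1))) := by
        rw [h₂, inner_add_right, real_inner_smul_right]
      have h₄ : u n - u (n + 1) = r • gradient f (u (n + 1)) := by
        rw [← hu n, add_sub_cancel_left]
      rw [h₄, real_inner_smul_right, real_inner_self_eq_norm_sq] at h₁
      have h₅ := real_inner_le_norm p (gradient f (u (n + 1)))
      have h₆ := hnorm (u (n + 1))
      have h₇ : (‖gradient f (u (n + 1))‖ - ‖p‖) ^ 2
          ≤ ‖gradient f (u (n + 1))‖ ^ 2 - inner ℝ p (gradient f (u (n + 1))) := by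
        nlinarith [norm_nonneg p]
      have h₈ := mul_le_mul_of_nonneg_left h₇ hr.le
      linarith
    · have := hf.add_inner_gradient_le hd x (u n)
      rw [hx, inner_sub_right] at this
      linarith
  rw [← tendsto_add_atTop_iff_nat 1, ← tendsto_sub_nhds_zero_iff]
  have := (hsq.const_mul (1 / r)).sqrt
  refine (this.congr fun n => ?_).trans (by simp)
  have h₁ : 1 / r * (r * (‖gradient f (u (n + 1))‖ - ‖p‖) ^ 2)
      = (‖gradient f (u (n + 1))‖ - ‖p‖) ^ 2 := by field_simp
  rw [h₁, Real.sqrt_sq (by linarith [hnorm (u (n + 1))])]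

/-- If the gradients of `f` along `u` approach the minimal norm, then `f - ⟪p, ·⟫` approaches
its minimum along `u`, provided `u` stays close to a ray of minimizers. -/
theorem ConvexOn.tendsto_sub_inner (hf : ConvexOn ℝ univ f) (hd : Differentiable ℝ f)
    {p x : H} (hp : ∀ z, ‖p‖ ^ 2 ≤ inner ℝ p (gradient f z)) (hx : gradient f x = p)
    {u : ℕ → H} (hu : Tendsto (fun n => ‖gradient f (u n)‖) atTop (𝓝 ‖p‖))
    {s : ℕ → ℝ} (hs : ∀ n, 0 ≤ s n) {R : ℝ} (hR : ∀ n, ‖u n - (x - s n • p)‖ ≤ R) :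
    Tendsto (fun n => f (u n) - inner ℝ p (u n)) atTop (𝓝 (f x - inner ℝ p x)) := by
  have hlim : Tendsto (fun n => √(‖gradient f (u n)‖ ^ 2 - ‖p‖ ^ 2) * R) atTop (𝓝 0) := by
    have h₁ := (hu.pow 2).sub_const (‖p‖ ^ 2)
    rw [sub_self] at h₁
    simpa using h₁.sqrt.mul_const R
  rw [← tendsto_sub_nhds_zero_iff]
  refine squeeze_zero (fun n => ?_) (fun n => ?_) hlim
  · have := hf.add_inner_gradient_le hd x (u n)
    rw [hx, inner_sub_right] at this
    linarith
  · obtain ⟨-, hval⟩ := hf.gradient_sub_smul_eq hd hp hx (hs n)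
    have h₁ := hf.add_inner_gradient_le hd (u n) (x - s n • p)
    have h₂ : f (u n) - inner ℝ p (u n) - (f x - inner ℝ p x)
        ≤ inner ℝ (gradient f (u n) - p) (u n - (x - s n • p)) := by
      rw [hval] at h₁
      rw [← neg_sub (u n), inner_neg_right] at h₁
      rw [inner_sub_left, inner_sub_right p, inner_sub_right p, real_inner_smul_right,
        real_inner_self_eq_norm_sq]
      linarith
    have h₃ : ‖gradient f (u n) - p‖ ≤ √(‖gradient f (u n)‖ ^ 2 - ‖p‖ ^ 2) := by
      apply Real.le_sqrt_of_sq_le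
      rw [norm_sub_sq_real, real_inner_comm]
      linarith [hp (u n)]
    refine (h₂.trans (real_inner_le_norm _ _)).trans ?_
    gcongr
    exact hR n

theorem ConvexOn.norm_prox_sub_le (hf : ConvexOn ℝ univ f) (hd : Differentiable ℝ f)
    {r : ℝ} (hr : 0 ≤ r) (a b : H) :
    ‖a - b‖ ≤ ‖(a + r • gradient f a) - (b + r • gradient f b)‖ := by
  have h₁ : (a + r • gradient f a) - (b + r • gradient f b)
      = (a - b) + r • (gradient f a - gradient f b) := by module
  have h₂ := mul_nonneg hr (hf.inner_gradient_sub_nonneg hd a b)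
  rw [h₁, ← sq_le_sq₀ (norm_nonneg _) (norm_nonneg _), norm_add_sq_real, real_inner_smul_right,
    real_inner_comm]
  nlinarith [sq_nonneg ‖r • (gradient f a - gradient f b)‖]

/-- Along the proximal step of `f`, the difference `f - g` decreases up to a small error. -/
theorem ConvexOn.prox_step_sub_le (hf : ConvexOn ℝ univ f) (hg : ConvexOn ℝ univ g)
    (hdf : Differentiable ℝ f) (hdg : Differentiable ℝ g)
    (hnorm : ∀ x, ‖gradient f x‖ = ‖gradient g x‖) {r : ℝ} (hr : 0 < r) {a b : H}
    (hab : b + r • gradient f b = a) :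
    ‖gradient f b‖ ≤ ‖gradient f a‖ ∧
      f b - g b - r * ‖gradient f b‖ * (‖gradient f a‖ - ‖gradient f b‖) ≤ f a - g a := by
  have hsub : a - b = r • gradient f b := by rw [← hab, add_sub_cancel_left]
  constructor
  · have h₁ := hf.inner_gradient_sub_nonneg hdf a b
    rw [hsub, real_inner_smul_right, inner_sub_left, real_inner_self_eq_norm_sq] at h₁
    have h₂ := nonneg_of_mul_nonneg_right h₁ hr
    have h₃ := real_inner_le_norm (gradient f a) (gradient f b)
    by_contra! h₄
    nlinarith [norm_nonneg (gradient f a)]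
  · have h₁ := hf.add_inner_gradient_le hdf b a
    have h₂ := hg.add_inner_gradient_le hdg a b
    rw [← neg_sub a b, inner_neg_right, hsub, real_inner_smul_right] at h₂
    rw [hsub, real_inner_smul_right, real_inner_self_eq_norm_sq] at h₁
    have h₃ := real_inner_le_norm (gradient g a) (gradient f b)
    rw [← hnorm] at h₃
    have h₄ := mul_le_mul_of_nonneg_left h₃ hr.le
    linarith

theorem ConvexOn.sub_le_sub_of_norm_gradient_eq (hf : ConvexOn ℝ univ f) (hg : ConvexOn ℝ univ g)
    (hdf : Differentiable ℝ f) (hdg : Differentiable ℝ g)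
    (hnorm : ∀ x, ‖gradient f x‖ = ‖gradient g x‖) {p x : H}
    (hpf : ∀ z, ‖p‖ ^ 2 ≤ inner ℝ p (gradient f z))
    (hpg : ∀ z, ‖p‖ ^ 2 ≤ inner ℝ p (gradient g z))
    (hxf : gradient f x = p) (hxg : gradient g x = p) (y : H) : f x - g x ≤ f y - g y := by
  have key (r : ℝ) (hr : 0 < r) : f x - g x - r * ‖gradient f y‖ ^ 2 ≤ f y - g y := by
    choose J hJ using hf.exists_add_smul_gradient_eq hdf hr
    set u : ℕ → H := fun n => J^[n] y with hu_def
    have hu (n : ℕ) : u (n + 1) + r • gradient f (u (n + 1)) = u n := by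
      simp only [hu_def, Function.iterate_succ_apply']
      exact hJ _
    have hs (n : ℕ) : (0 : ℝ) ≤ n * r := by positivity
    have hR (n : ℕ) : ‖u n - (x - ((n : ℝ) * r) • p)‖ ≤ ‖y - x‖ := by
      induction n with
      | zero => simp [hu_def]
      | succ n ih =>
        refine (hf.norm_prox_sub_le hdf hr.le _ _).trans (le_of_eq_of_le ?_ ih)
        rw [hu, (hf.gradient_sub_smul_eq hdf hpf hxf (hs (n + 1))).1]
        congr 2
        push_cast
        module
    have hlimf := hf.tendsto_norm_gradient_prox hdf hpf hxf hr hu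
    have hlim := (hf.tendsto_sub_inner hdf hpf hxf hlimf hs hR).sub
      (hg.tendsto_sub_inner hdg hpg hxg (by simpa only [hnorm] using hlimf) hs hR)
    have hbound (n : ℕ) : ‖gradient f (u n)‖ ≤ ‖gradient f y‖ ∧
        f (u n) - g (u n) - r * ‖gradient f y‖ * (‖gradient f y‖ - ‖gradient f (u n)‖)
          ≤ f y - g y := by
      induction n with
      | zero => simp [hu_def]
      | succ n ih =>
        obtain ⟨h₁, h₂⟩ := hf.prox_step_sub_le hg hdf hdg hnorm hr (hu n)
        refine ⟨h₁.trans ih.1, ?_⟩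
        have h₃ := mul_le_mul_of_nonneg_right (mul_le_mul_of_nonneg_left (h₁.trans ih.1) hr.le)
          (sub_nonneg.2 h₁)
        linarith [ih.2]
    have hle : f x - inner ℝ p x - (g x - inner ℝ p x)
        ≤ f y - g y + r * ‖gradient f y‖ ^ 2 := by
      refine le_of_tendsto' hlim fun n => ?_
      have h₁ : 0 ≤ r * ‖gradient f y‖ * ‖gradient f (u n)‖ := by positivity
      linarith [(hbound n).2]
    linarith
  have hlim : Tendsto (fun r : ℝ => f x - g x - r * ‖gradient f y‖ ^ 2) (𝓝[>] 0)
      (𝓝 (f x - g x)) := by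
    have : Continuous fun r : ℝ => f x - g x - r * ‖gradient f y‖ ^ 2 := by fun_prop
    simpa using (this.tendsto 0).mono_left nhdsWithin_le_nhds
  exact le_of_tendsto hlim (eventually_nhdsWithin_of_forall key)

end

/-- **Determination of convex `C¹` functions when the Crandall–Pazy direction is attained.**
If `f, g : H → ℝ` are convex and continuously Fréchet differentiable, have equal gradient
norms everywhere, have the same Crandall–Pazy direction `pf = pg` (the element of minimal
norm of the closure of the range of the gradient), and this direction is attained as a
gradient `∇f xhat = pf`, then `f` and `g` differ by an additive constant. -/
theorem determination_C1_CP_attained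
    {H : Type*} [NormedAddCommGroup H] [InnerProductSpace ℝ H] [CompleteSpace H]
    (f g : H → ℝ)
    (hfconv : ConvexOn ℝ Set.univ f) (hgconv : ConvexOn ℝ Set.univ g)
    (hfsmooth : ContDiff ℝ 1 f) (hgsmooth : ContDiff ℝ 1 g)
    (pf pg : H)
    (hpf : pf ∈ closure (Set.range (gradient f)) ∧
      ∀ q ∈ closure (Set.range (gradient f)), ‖pf‖ ≤ ‖q‖)
    (hpg : pg ∈ closure (Set.range (gradient g)) ∧
      ∀ q ∈ closure (Set.range (gradient g)), ‖pg‖ ≤ ‖q‖)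
    (hnorm : ∀ x, ‖gradient f x‖ = ‖gradient g x‖)
    (hp : pf = pg)
    (xhat : H) (hatt : gradient f xhat = pf) :
    ∃ c : ℝ, ∀ x, f x = g x + c := by
  subst hp
  have hdf : Differentiable ℝ f := hfsmooth.differentiable one_ne_zero
  have hdg : Differentiable ℝ g := hgsmooth.differentiable one_ne_zero
  have hf (z : H) : ‖pf‖ ^ 2 ≤ inner ℝ pf (gradient f z) :=
    (hfconv.convex_closure_range_gradient hdf).sq_norm_le_inner_of_forall_norm_le hpf.1 hpf.2
      (subset_closure (mem_range_self z))
  have hg (z : H) : ‖pf‖ ^ 2 ≤ inner ℝ pf (gradient g z) :=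
    (hgconv.convex_closure_range_gradient hdg).sq_norm_le_inner_of_forall_norm_le hpg.1 hpg.2
      (subset_closure (mem_range_self z))
  have hattg : gradient g xhat = pf := by
    rw [← sub_eq_zero, ← norm_eq_zero, ← sq_eq_zero_iff]
    refine le_antisymm ?_ (sq_nonneg _)
    rw [norm_sub_sq_real, ← hnorm, hatt, real_inner_comm]
    linarith [hg xhat]
  refine ⟨f xhat - g xhat, fun x => ?_⟩
  have h₁ := hfconv.sub_le_sub_of_norm_gradient_eq hgconv hdf hdg hnorm hf hg hatt hattg x
  have h₂ := hgconv.sub_le_sub_of_norm_gradient_eq hfconv hdg hdf (fun z => (hnorm z).symm)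
    hg hf hattg hatt x
  linarith
end

section
/- Let H be a real Hilbert space, f : H → ℝ ∪ {+∞} a proper lower semicontinuous convex function, and x, y ∈ dom f. For t ≥ 0 and λ ∈ [0, 1], let w_t(λ) = S_f(λx + (1−λ)y, t) be the value at time t of the subgradient curve of f emanating from λx + (1−λ)y (so that w_t(λ) ∈ dom ∂f for every t > 0). Then lim_{t→+∞} sup{ ‖∂°f(w_t(λ))‖ : λ ∈ [0, 1] } = ‖p_f‖, where p_f is the Crandall–Pazy direction of f. -/
open Set Filter MeasureTheory RealInnerProductSpace
open scoped ENNReal NNReal Classical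

variable {H : Type*} [NormedAddCommGroup H] [InnerProductSpace ℝ H] [CompleteSpace H]

/-- The convex subdifferential of an extended-real-valued function `f` at `x`. -/
def SubdiffE (f : H → EReal) (x : H) : Set H :=
  {p | ∀ y, f x + ((⟪p, y - x⟫ : ℝ) : EReal) ≤ f y}

/-- Convexity for extended-real-valued functions. -/
def ConvexE (f : H → EReal) : Prop :=
  ∀ x y : H, ∀ a b : ℝ, 0 ≤ a → 0 ≤ b → a + b = 1 →
    f (a • x + b • y) ≤ (a : EReal) * f x + (b : EReal) * f y

/-- The element of minimal norm of a set (defined when it exists, `0` otherwise).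
For a nonempty closed convex subset of a Hilbert space this is the projection of `0`. -/
noncomputable def minNormElt (S : Set H) : H :=
  if h : ∃ p ∈ S, ∀ q ∈ S, ‖p‖ ≤ ‖q‖ then h.choose else 0

/-- The slope of `f` at `x`: `dist(0, ∂f(x))`, with value `⊤` when `∂f(x) = ∅`. -/
noncomputable def slopeE (f : H → EReal) (x : H) : ℝ≥0∞ :=
  ⨅ p ∈ SubdiffE f x, (‖p‖₊ : ℝ≥0∞)

/-- `γ : [0,∞) → H` is the subgradient curve of `f` emanating from `x`:
a locally absolutely continuous curve with `γ 0 = x` and `γ' t ∈ -∂f(γ t)` a.e. -/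
def IsSubgradientCurve (f : H → EReal) (x : H) (γ : ℝ → H) : Prop :=
  γ 0 = x ∧ ContinuousOn γ (Set.Ici 0) ∧
  ∃ v : ℝ → H,
    (∀ t > 0, MeasureTheory.IntegrableOn v (Set.Ioc 0 t)) ∧
    (∀ t ≥ 0, γ t = x + ∫ s in Set.Ioc 0 t, v s) ∧
    (∀ᵐ t ∂(MeasureTheory.volume.restrict (Set.Ioi (0:ℝ))), -v t ∈ SubdiffE f (γ t))

set_option linter.unusedSectionVars false in
lemma SubdiffE.ne_top {f : H → EReal} (hproper : ∃ y, f y ≠ ⊤) {x p : H}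
    (hp : p ∈ SubdiffE f x) : f x ≠ ⊤ := by
  obtain ⟨y, hy⟩ := hproper
  intro hx
  have h := hp y
  rw [hx, EReal.top_add_coe] at h
  exact hy (top_le_iff.mp h)

set_option linter.unusedSectionVars false in
lemma SubdiffE.toReal_add_inner_le {f : H → EReal} (hproper : ∃ y, f y ≠ ⊤)
    (hnobot : ∀ y, f y ≠ ⊥) {x p z : H} (hp : p ∈ SubdiffE f x) (hz : f z ≠ ⊤) :
    (f x).toReal + ⟪p, z - x⟫ ≤ (f z).toReal := by
  have h := hp z
  rw [← EReal.coe_toReal (SubdiffE.ne_top hproper hp) (hnobot x),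
    ← EReal.coe_toReal hz (hnobot z)] at h
  exact_mod_cast h

set_option linter.unusedSectionVars false in
lemma SubdiffE.inner_sub_nonneg {f : H → EReal} (hproper : ∃ y, f y ≠ ⊤)
    (hnobot : ∀ y, f y ≠ ⊥) {x p z q : H} (hp : p ∈ SubdiffE f x) (hq : q ∈ SubdiffE f z) :
    0 ≤ ⟪p - q, x - z⟫ := by
  have h1 := SubdiffE.toReal_add_inner_le hproper hnobot hp (SubdiffE.ne_top hproper hq)
  have h2 := SubdiffE.toReal_add_inner_le hproper hnobot hq (SubdiffE.ne_top hproper hp)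
  have h3 : ⟪p, z - x⟫ = -⟪p, x - z⟫ := by rw [← inner_neg_right, neg_sub]
  rw [inner_sub_left]
  linarith

/-- Bounded sequences in a Hilbert space have weak cluster points along an ultrafilter. -/
lemma exists_ultrafilter_tendsto_inner {ps : ℕ → H} {L : ℝ} (hL : ∀ n, ‖ps n‖ ≤ L) :
    ∃ (U : Ultrafilter ℕ) (p : H), (U : Filter ℕ) ≤ atTop ∧
      ∀ z, Tendsto (fun n => ⟪ps n, z⟫) U (nhds ⟪p, z⟫) := by
  obtain ⟨U, hU⟩ := Ultrafilter.exists_le (atTop : Filter ℕ)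
  let φ : ℕ → WeakDual ℝ H := fun n =>
    StrongDual.toWeakDual (InnerProductSpace.toDual ℝ H (ps n))
  have hK := WeakDual.isCompact_closedBall (𝕜 := ℝ) (E := H) 0 L
  obtain ⟨ξ, -, hξ⟩ := hK.ultrafilter_le_nhds (U.map φ) (by
    rw [le_principal_iff]
    refine Filter.mem_map.mpr (Filter.univ_mem' fun n => ?_)
    simpa [φ] using hL n)
  refine ⟨U, (InnerProductSpace.toDual ℝ H).symm (WeakDual.toStrongDual ξ), hU, fun z => ?_⟩
  have h : Tendsto φ U (nhds ξ) := hξ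
  have h2 := ((WeakDual.eval_continuous (𝕜 := ℝ) z).tendsto ξ).comp h
  rw [InnerProductSpace.toDual_symm_apply]
  exact h2

/-- The graph of the subdifferential is closed under strong-weak limits of bounded sequences. -/
lemma exists_mem_subdiffE_of_tendsto {f : H → EReal} (hlsc : LowerSemicontinuous f) {x : H}
    {xs ps : ℕ → H} (hxs : Tendsto xs atTop (nhds x))
    (hps : ∀ n, ps n ∈ SubdiffE f (xs n)) {L : ℝ} (hL : ∀ n, ‖ps n‖ ≤ L) :
    ∃ p ∈ SubdiffE f x, ∀ c, (∀ᶠ n in atTop, ‖ps n‖ ≤ c) → ‖p‖ ≤ c := by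
  obtain ⟨U, p, hU, hp⟩ := exists_ultrafilter_tendsto_inner hL
  refine ⟨p, fun z => ?_, fun c hc => ?_⟩
  · by_cases hz : f z = ⊤
    · rw [hz]; exact le_top
    have hsmall : Tendsto (fun n => ⟪ps n, x - xs n⟫) U (nhds 0) := by
      refine squeeze_zero_norm (a := fun n => L * ‖x - xs n‖) (fun n => ?_) ?_
      · exact (norm_inner_le_norm _ _).trans
          (mul_le_mul_of_nonneg_right (hL n) (norm_nonneg _))
      · have h : Tendsto (fun n => L * ‖x - xs n‖) atTop (nhds (L * ‖x - x‖)) :=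
          ((tendsto_const_nhds.sub hxs).norm).const_mul L
        simp only [sub_self, norm_zero, mul_zero] at h
        exact h.mono_left hU
    have hlim : Tendsto (fun n => ⟪ps n, z - xs n⟫) U (nhds ⟪p, z - x⟫) := by
      have h := (hp (z - x)).add hsmall
      simp only [← inner_add_right, sub_add_sub_cancel, add_zero] at h
      exact h
    refine EReal.add_le_of_forall_lt fun a ha b hb => ?_
    have ev1 : ∀ᶠ n in (U : Filter ℕ), a < f (xs n) :=
      (hxs.eventually (hlsc x a ha)).filter_mono hU
    have ev2 : ∀ᶠ n in (U : Filter ℕ), b < ((⟪ps n, z - xs n⟫ : ℝ) : EReal) :=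
      (continuous_coe_real_ereal.continuousAt.tendsto.comp hlim) (lt_mem_nhds hb)
    obtain ⟨n, h1, h2⟩ := (ev1.and ev2).exists
    exact (add_le_add h1.le h2.le).trans (hps n z)
  · have hle : ⟪p, p⟫ ≤ c * ‖p‖ := by
      refine le_of_tendsto (hp p) ((hc.filter_mono hU).mono fun n hn => ?_)
      exact (real_inner_le_norm _ _).trans (mul_le_mul_of_nonneg_right hn (norm_nonneg _))
    obtain ⟨n, hn⟩ := hc.exists
    have hc0 : 0 ≤ c := (norm_nonneg _).trans hn
    rw [real_inner_self_eq_norm_mul_norm] at hle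
    by_contra! hcon
    nlinarith [norm_nonneg p]

lemma minNormElt_spec {f : H → EReal} (hlsc : LowerSemicontinuous f) {x : H}
    (hne : (SubdiffE f x).Nonempty) :
    minNormElt (SubdiffE f x) ∈ SubdiffE f x ∧
      ∀ q ∈ SubdiffE f x, ‖minNormElt (SubdiffE f x)‖ ≤ ‖q‖ := by
  have hex : ∃ p ∈ SubdiffE f x, ∀ q ∈ SubdiffE f x, ‖p‖ ≤ ‖q‖ := by
    have hbdd : BddBelow (norm '' SubdiffE f x) := ⟨0, by rintro _ ⟨q, -, rfl⟩; positivity⟩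
    obtain ⟨u, hu_anti, hu_lim, hu_mem⟩ :=
      exists_seq_tendsto_sInf (hne.image norm) hbdd
    choose ps hps hpu using hu_mem
    obtain ⟨p, hp, hpc⟩ := exists_mem_subdiffE_of_tendsto hlsc
      (tendsto_const_nhds (x := x)) hps (L := u 0)
      (fun n => by rw [hpu n]; exact hu_anti (Nat.zero_le n))
    refine ⟨p, hp, fun q hq => (?_ : ‖p‖ ≤ sInf (norm '' SubdiffE f x)).trans
      (csInf_le hbdd ⟨q, hq, rfl⟩)⟩
    exact le_of_forall_gt_imp_ge_of_dense fun c hc => hpc c <|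
      (hu_lim.eventually_lt_const hc).mono fun n hn => (hpu n).le.trans hn.le
  have h := hex.choose_spec
  rw [minNormElt, dif_pos hex]
  exact h

lemma AbsolutelyContinuousOnInterval.of_dist_le {X Y : Type*} [PseudoMetricSpace X]
    [PseudoMetricSpace Y] {F : ℝ → X} {V : ℝ → Y} {a b : ℝ}
    (hV : AbsolutelyContinuousOnInterval V a b)
    (h : ∀ s ∈ uIcc a b, ∀ t ∈ uIcc a b, dist (F s) (F t) ≤ dist (V s) (V t)) :
    AbsolutelyContinuousOnInterval F a b := by
  rw [absolutelyContinuousOnInterval_iff] at hV ⊢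
  intro ε hε
  obtain ⟨δ, hδ, hsum⟩ := hV ε hε
  refine ⟨δ, hδ, fun E hE hs => (Finset.sum_le_sum fun i hi => ?_).trans_lt (hsum E hE hs)⟩
  exact h _ (hE.1 i hi).1 _ (hE.1 i hi).2

lemma AbsolutelyContinuousOnInterval.norm_sq {E : Type*} [SeminormedAddCommGroup E]
    {u : ℝ → E} {a b : ℝ} (hu : AbsolutelyContinuousOnInterval u a b) :
    AbsolutelyContinuousOnInterval (fun t => ‖u t‖ ^ 2) a b := by
  have h : AbsolutelyContinuousOnInterval (fun t => ‖u t‖) a b :=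
    hu.of_dist_le fun s _ t _ => (dist_norm_norm_le _ _).trans_eq (dist_eq_norm _ _).symm
  simpa only [sq] using h.fun_mul h

lemma AbsolutelyContinuousOnInterval.of_integral {E : Type*} [NormedAddCommGroup E]
    [NormedSpace ℝ E] {u w : ℝ → E} {a b : ℝ} (hw : IntervalIntegrable w volume a b)
    (hu : ∀ s ∈ uIcc a b, ∀ t ∈ uIcc a b, u t - u s = ∫ r in s..t, w r) :
    AbsolutelyContinuousOnInterval u a b := by
  refine (hw.norm.absolutelyContinuousOnInterval_intervalIntegral (c := a) left_mem_uIcc).of_dist_le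
    fun s hs t ht => ?_
  have hi : ∀ r ∈ uIcc a b, IntervalIntegrable (fun x => ‖w x‖) volume a r := fun r hr =>
    hw.norm.mono_set (uIcc_subset_uIcc_left hr)
  rw [dist_comm, dist_eq_norm, hu s hs t ht, dist_comm, Real.dist_eq,
    intervalIntegral.integral_interval_sub_left (hi t ht) (hi s hs)]
  exact intervalIntegral.norm_integral_le_abs_integral_norm

/-- An absolutely continuous function with almost everywhere nonpositive derivative decreases. -/
lemma AbsolutelyContinuousOnInterval.le_of_ae_deriv_nonpos {F : ℝ → ℝ} {a b : ℝ} (hab : a ≤ b)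
    (hF : AbsolutelyContinuousOnInterval F a b)
    (h : ∀ᵐ t, t ∈ Ioo a b → ∃ F', HasDerivAt F F' t ∧ F' ≤ 0) : F b ≤ F a := by
  have h1 := hF.integral_deriv_eq_sub
  have h2 : ∫ t in a..b, deriv F t ≤ 0 := by
    rw [intervalIntegral.integral_of_le hab, integral_Ioc_eq_integral_Ioo]
    refine integral_nonpos_of_ae ?_
    rw [EventuallyLE, ae_restrict_iff' measurableSet_Ioo]
    filter_upwards [h] with t ht hmem
    obtain ⟨F', hd, hle⟩ := ht hmem
    simpa [hd.deriv] using hle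
  linarith

/-- A subgradient curve is the integral of a velocity field which is, almost everywhere, both its
derivative and minus a subgradient. -/
lemma IsSubgradientCurve.exists_velocity {f : H → EReal} {x : H} {γ : ℝ → H}
    (hγ : IsSubgradientCurve f x γ) :
    ∃ v : ℝ → H, (∀ a ≥ 0, ∀ b ≥ 0, IntervalIntegrable v volume a b) ∧
      (∀ a ≥ 0, ∀ b ≥ 0, γ b - γ a = ∫ r in a..b, v r) ∧
      ∀ᵐ t, 0 < t → -v t ∈ SubdiffE f (γ t) ∧ HasDerivAt γ (v t) t := by
  obtain ⟨-, -, v, hint, hv, hsub⟩ := hγ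
  have h0 : ∀ b ≥ 0, IntervalIntegrable v volume 0 b := by
    intro b hb
    rw [intervalIntegrable_iff_integrableOn_Ioc_of_le hb]
    rcases hb.eq_or_lt with rfl | hb
    · simp
    · exact hint b hb
  have hI : ∀ a ≥ 0, ∀ b ≥ 0, IntervalIntegrable v volume a b := fun a ha b hb =>
    (h0 a ha).symm.trans (h0 b hb)
  have hγ0 : ∀ t ≥ 0, γ t = x + ∫ r in (0 : ℝ)..t, v r := fun t ht => by
    rw [hv t ht, intervalIntegral.integral_of_le ht]
  refine ⟨v, hI, fun a ha b hb => ?_, ?_⟩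
  · rw [hγ0 a ha, hγ0 b hb, add_sub_add_left_eq_sub,
      intervalIntegral.integral_interval_sub_left (h0 b hb) (h0 a ha)]
  · have hd : ∀ n : ℕ, ∀ᵐ t, t ∈ uIcc (0 : ℝ) n → ∀ c ∈ uIcc (0 : ℝ) n,
        HasDerivAt (fun x => ∫ r in c..x, v r) (v t) t := fun n =>
      (h0 n n.cast_nonneg).ae_hasDerivAt_integral
    rw [ae_restrict_iff' measurableSet_Ioi] at hsub
    filter_upwards [hsub, ae_all_iff.mpr hd] with t ht hdt h_pos
    refine ⟨ht h_pos, ?_⟩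
    obtain ⟨n, hn⟩ := exists_nat_ge t
    have h := (hdt n (by rw [uIcc_of_le n.cast_nonneg]; exact ⟨h_pos.le, hn⟩) 0
      left_mem_uIcc).const_add x
    refine h.congr_of_eventuallyEq ?_
    filter_upwards [lt_mem_nhds h_pos] with s hs using hγ0 s hs.le

lemma exists_mem_Ioo_of_ae {P : ℝ → Prop} (h : ∀ᵐ t, P t) {a b : ℝ} (hab : a < b) :
    ∃ t ∈ Ioo a b, P t := by
  obtain ⟨t, ht, h1⟩ := (Measure.dense_of_ae h).exists_between hab
  exact ⟨t, h1, ht⟩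

/-- Along a subgradient curve, displacements over a fixed time lapse are nonincreasing. -/
lemma IsSubgradientCurve.norm_shift_sub_le {f : H → EReal} (hproper : ∃ y, f y ≠ ⊤)
    (hnobot : ∀ y, f y ≠ ⊥) {x : H} {γ : ℝ → H} (hγ : IsSubgradientCurve f x γ)
    {h s t : ℝ} (hh : 0 ≤ h) (hs : 0 ≤ s) (hst : s ≤ t) :
    ‖γ (t + h) - γ t‖ ≤ ‖γ (s + h) - γ s‖ := by
  obtain ⟨v, hint, hsub, hae⟩ := hγ.exists_velocity
  have hnn : ∀ r ∈ uIcc s t, 0 ≤ r := fun r hr => by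
    rw [uIcc_of_le hst] at hr; exact hs.trans hr.1
  have ac1 : AbsolutelyContinuousOnInterval γ s t :=
    .of_integral (hint s hs t (hs.trans hst)) fun a ha b hb => hsub a (hnn a ha) b (hnn b hb)
  have ac2 : AbsolutelyContinuousOnInterval (fun r => γ (r + h)) s t := by
    refine .of_integral (w := fun r => v (r + h)) ?_ fun a ha b hb => ?_
    · have := (hint (s + h) (by linarith) (t + h) (by linarith)).comp_add_right h
      simpa using this
    · rw [intervalIntegral.integral_comp_add_right]
      exact hsub _ (add_nonneg (hnn a ha) hh) _ (add_nonneg (hnn b hb) hh)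
  have hae2 := (measurePreserving_add_right (volume : Measure ℝ) h).quasiMeasurePreserving.ae hae
  have key := (ac2.fun_sub ac1).norm_sq.le_of_ae_deriv_nonpos hst (by
    filter_upwards [hae, hae2] with r h1 h2 hr
    obtain ⟨hs1, hd1⟩ := h1 (hs.trans_lt hr.1)
    obtain ⟨hs2, hd2⟩ := h2 (by linarith [hr.1])
    refine ⟨_, ((hd2.comp_add_const r h).sub hd1).norm_sq, ?_⟩
    have := SubdiffE.inner_sub_nonneg hproper hnobot hs2 hs1
    rw [real_inner_comm, neg_sub_neg, ← neg_sub (v (r + h)), inner_neg_right] at this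
    simp only [Pi.sub_apply]
    linarith)
  exact le_of_sq_le_sq key (norm_nonneg _)

lemma IsSubgradientCurve.norm_deriv_le {f : H → EReal} (hproper : ∃ y, f y ≠ ⊤)
    (hnobot : ∀ y, f y ≠ ⊥) {x : H} {γ : ℝ → H} (hγ : IsSubgradientCurve f x γ)
    {s t : ℝ} (hs : 0 ≤ s) (hst : s ≤ t) {a b : H} (ha : HasDerivAt γ a s)
    (hb : HasDerivAt γ b t) : ‖b‖ ≤ ‖a‖ := by
  refine le_of_tendsto_of_tendsto hb.tendsto_slope_zero_right.norm
    ha.tendsto_slope_zero_right.norm ?_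
  filter_upwards [self_mem_nhdsWithin] with h hh
  rw [norm_smul, norm_smul]
  exact mul_le_mul_of_nonneg_left
    (hγ.norm_shift_sub_le hproper hnobot (le_of_lt hh) hs hst) (norm_nonneg _)

lemma IsSubgradientCurve.exists_subgradient_norm_le {f : H → EReal} (hproper : ∃ y, f y ≠ ⊤)
    (hnobot : ∀ y, f y ≠ ⊥) (hlsc : LowerSemicontinuous f) {x : H} {γ : ℝ → H}
    (hγ : IsSubgradientCurve f x γ) {s t : ℝ} (hs : 0 < s) (hst : s ≤ t) {a : H}
    (ha : HasDerivAt γ a s) : ∃ p ∈ SubdiffE f (γ t), ‖p‖ ≤ ‖a‖ := by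
  obtain ⟨v, -, -, hae⟩ := hγ.exists_velocity
  have hex : ∀ n : ℕ, ∃ r ∈ Ioo t (t + 1 / ((n : ℝ) + 1)),
      0 < r → -v r ∈ SubdiffE f (γ r) ∧ HasDerivAt γ (v r) r := fun n =>
    exists_mem_Ioo_of_ae hae (lt_add_of_pos_right t Nat.one_div_pos_of_nat)
  choose r hr hgood using hex
  have ht : 0 < t := hs.trans_le hst
  have hlim : Tendsto r atTop (nhds t) := by
    refine tendsto_of_tendsto_of_tendsto_of_le_of_le tendsto_const_nhds ?_
      (fun n => (hr n).1.le) (fun n => (hr n).2.le)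
    simpa using tendsto_const_nhds.add (tendsto_one_div_add_atTop_nhds_zero_nat (𝕜 := ℝ))
  have hgood' := fun n => hgood n (ht.trans (hr n).1)
  have hle : ∀ n, ‖-v (r n)‖ ≤ ‖a‖ := fun n => by
    rw [norm_neg]
    exact hγ.norm_deriv_le hproper hnobot hs.le (hst.trans (hr n).1.le) ha (hgood' n).2
  obtain ⟨p, hp, hpc⟩ := exists_mem_subdiffE_of_tendsto hlsc
    ((hγ.2.1.continuousAt (Ici_mem_nhds ht)).tendsto.comp hlim) (fun n => (hgood' n).1) hle
  exact ⟨p, hp, hpc _ (Eventually.of_forall hle)⟩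

lemma IsSubgradientCurve.subdiffE_nonempty {f : H → EReal} (hproper : ∃ y, f y ≠ ⊤)
    (hnobot : ∀ y, f y ≠ ⊥) (hlsc : LowerSemicontinuous f) {x : H} {γ : ℝ → H}
    (hγ : IsSubgradientCurve f x γ) {t : ℝ} (ht : 0 < t) : (SubdiffE f (γ t)).Nonempty := by
  obtain ⟨v, -, -, hae⟩ := hγ.exists_velocity
  obtain ⟨s, hs, hgood⟩ := exists_mem_Ioo_of_ae hae ht
  obtain ⟨p, hp, -⟩ := hγ.exists_subgradient_norm_le hproper hnobot hlsc hs.1 hs.2.le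
    (hgood hs.1).2
  exact ⟨p, hp⟩

/-- Away from time zero, `f` is Lipschitz along a subgradient curve. -/
lemma IsSubgradientCurve.absolutelyContinuousOnInterval_toReal {f : H → EReal}
    (hproper : ∃ y, f y ≠ ⊤) (hnobot : ∀ y, f y ≠ ⊥) (hlsc : LowerSemicontinuous f) {x : H}
    {γ : ℝ → H} (hγ : IsSubgradientCurve f x γ) {s t : ℝ} (hs : 0 < s) (hst : s ≤ t) {a : H}
    (ha : HasDerivAt γ a s) :
    AbsolutelyContinuousOnInterval (fun r => (f (γ r)).toReal) s t := by
  obtain ⟨v, hint, hsub, hae⟩ := hγ.exists_velocity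
  have hnn : ∀ r ∈ uIcc s t, s ≤ r := fun r hr => by
    rw [uIcc_of_le hst] at hr; exact hr.1
  have hγac : AbsolutelyContinuousOnInterval γ s t :=
    .of_integral (hint s hs.le t (hs.le.trans hst)) fun b hb c hc =>
      hsub b (hs.le.trans (hnn b hb)) c (hs.le.trans (hnn c hc))
  have hone : ∀ b ∈ uIcc s t, ∀ c ∈ uIcc s t,
      (f (γ b)).toReal - (f (γ c)).toReal ≤ ‖a‖ * dist (γ b) (γ c) := by
    intro b hb c hc
    obtain ⟨p, hp, hpa⟩ := hγ.exists_subgradient_norm_le hproper hnobot hlsc hs (hnn b hb) ha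
    obtain ⟨q, hq, -⟩ := hγ.exists_subgradient_norm_le hproper hnobot hlsc hs (hnn c hc) ha
    have h1 := SubdiffE.toReal_add_inner_le hproper hnobot hp (SubdiffE.ne_top hproper hq)
    have h2 := neg_le_of_abs_le (abs_real_inner_le_norm p (γ c - γ b))
    rw [dist_comm, dist_eq_norm]
    nlinarith [norm_nonneg (γ c - γ b)]
  refine (hγac.const_smul ‖a‖).of_dist_le fun b hb c hc => ?_
  rw [dist_smul₀, norm_norm, Real.dist_eq, abs_le]
  have h1 := hone b hb c hc
  have h2 := hone c hc b hb
  rw [dist_comm] at h2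
  constructor <;> linarith

/-- A quantitative decay estimate for the minimal subgradients along a subgradient curve. -/
lemma IsSubgradientCurve.sq_mul_norm_minNormElt_sq_le {f : H → EReal}
    (hproper : ∃ y, f y ≠ ⊤) (hnobot : ∀ y, f y ≠ ⊥) (hlsc : LowerSemicontinuous f) {x : H}
    {γ : ℝ → H} (hγ : IsSubgradientCurve f x γ) {z q : H} (hq : q ∈ SubdiffE f z) {T : ℝ}
    (hT : 0 < T) :
    T ^ 2 * ‖minNormElt (SubdiffE f (γ T))‖ ^ 2 ≤ ‖x - z‖ ^ 2 + T ^ 2 * ‖q‖ ^ 2 := by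
  obtain ⟨v, hint, hsub, hae⟩ := hγ.exists_velocity
  set m := ‖minNormElt (SubdiffE f (γ T))‖ with hm
  have hz := SubdiffE.ne_top hproper hq
  have hne : ∀ t, 0 < t → f (γ t) ≠ ⊤ := fun t ht =>
    SubdiffE.ne_top hproper (hγ.subdiffE_nonempty hproper hnobot hlsc ht).some_mem
  have hmin := (minNormElt_spec hlsc
    (hγ.subdiffE_nonempty hproper hnobot hlsc hT)).2
  have hmv : ∀ t, 0 < t → t ≤ T → ∀ a, HasDerivAt γ a t → m ≤ ‖a‖ := by
    intro t ht htT a ha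
    obtain ⟨p, hp, hpa⟩ := hγ.exists_subgradient_norm_le hproper hnobot hlsc ht htT ha
    exact (hmin p hp).trans hpa
  have key : ∀ δ, 0 < δ → δ < T → (∃ a, HasDerivAt γ a δ) →
      (T - δ) ^ 2 * m ^ 2 ≤ ‖γ δ - z‖ ^ 2 + (T - δ) ^ 2 * ‖q‖ ^ 2 := by
    rintro δ hδ hδT ⟨a, ha⟩
    have hψac := hγ.absolutelyContinuousOnInterval_toReal hproper hnobot hlsc hδ hδT.le ha
    have hnn : ∀ r ∈ uIcc δ T, 0 ≤ r := fun r hr => by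
      rw [uIcc_of_le hδT.le] at hr; exact hδ.le.trans hr.1
    have hγac : AbsolutelyContinuousOnInterval (fun t => γ t - z) δ T :=
      .of_integral (hint δ hδ.le T hT.le) fun b hb c hc => by
        rw [sub_sub_sub_cancel_right]; exact hsub b (hnn b hb) c (hnn c hc)
    have hpoly : ∀ P : ℝ → ℝ, ContDiff ℝ 1 P → AbsolutelyContinuousOnInterval P δ T :=
      fun P hP => hP.contDiffOn.absolutelyContinuousOnInterval
    have hE : AbsolutelyContinuousOnInterval
        (fun t => ‖γ t - z‖ ^ 2 + 2 * (t - δ) * ((f (γ t)).toReal - (f z).toReal)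
          + (t - δ) ^ 2 * m ^ 2) δ T :=
      (hγac.norm_sq.fun_add ((hpoly (fun t => 2 * (t - δ)) (by fun_prop)).fun_mul
        (hψac.fun_sub (hpoly (fun _ => (f z).toReal) (by fun_prop))))).fun_add
        (hpoly (fun t => (t - δ) ^ 2 * m ^ 2) (by fun_prop))
    have hle := hE.le_of_ae_deriv_nonpos hδT.le (by
      filter_upwards [hae, hψac.ae_differentiableAt] with t h1 h2 ht
      have ht0 : 0 < t := hδ.trans ht.1
      obtain ⟨hs, hd⟩ := h1 ht0
      have hψ := (h2 (by rw [uIcc_of_le hδT.le]; exact Ioo_subset_Icc_self ht)).hasDerivAt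
      set d := deriv (fun r => (f (γ r)).toReal) t
      have hloc : IsLocalMin (fun r => (f (γ r)).toReal + ⟪v t, γ r⟫) t := by
        filter_upwards [lt_mem_nhds ht0] with r hr
        have := SubdiffE.toReal_add_inner_le hproper hnobot hs (hne r hr)
        rw [inner_neg_left, inner_sub_right] at this
        linarith
      have hd0 := hloc.hasDerivAt_eq_zero
        (hψ.add ((hasDerivAt_const t (v t)).inner ℝ hd))
      simp only [inner_zero_left, add_zero, real_inner_self_eq_norm_sq] at hd0
      have hid := (hasDerivAt_id t).sub_const δ
      refine ⟨_, ((hd.sub_const z).norm_sq.add ((hid.const_mul 2).mul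
        (hψ.sub_const (f z).toReal))).add ((hid.pow 2).mul_const (m ^ 2)), ?_⟩
      have hfz := SubdiffE.toReal_add_inner_le hproper hnobot hs hz
      have hin : ⟪-v t, z - γ t⟫ = ⟪γ t - z, v t⟫ := by
        rw [real_inner_comm, inner_neg_right, ← inner_neg_left, neg_sub]
      have hmt := hmv t ht0 ht.2.le _ hd
      have hmsq : m ^ 2 ≤ ‖v t‖ ^ 2 := pow_le_pow_left₀ (norm_nonneg _) hmt 2
      have hd' : d = -‖v t‖ ^ 2 := by linarith
      simp only [id, hd', Nat.cast_ofNat, Nat.add_one_sub_one, pow_one, mul_one]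
      nlinarith [mul_nonneg (sub_nonneg.2 ht.1.le) (sub_nonneg.2 hmsq)])
    have hqT := SubdiffE.toReal_add_inner_le hproper hnobot hq (hne T hT)
    have hcs := neg_le_of_abs_le (abs_real_inner_le_norm q (γ T - z))
    simp only [sub_self, mul_zero, zero_mul, add_zero, ne_eq, OfNat.ofNat_ne_zero,
      not_false_eq_true, zero_pow] at hle
    have hprod := mul_nonneg (sub_nonneg.2 hδT.le) (sub_nonneg.2 (show
      -(‖q‖ * ‖γ T - z‖) ≤ (f (γ T)).toReal - (f z).toReal by linarith))
    nlinarith [sq_nonneg (‖γ T - z‖ - (T - δ) * ‖q‖)]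
  by_contra! hcon
  have hcont : Tendsto (fun δ => ‖γ δ - z‖ ^ 2 + (T - δ) ^ 2 * ‖q‖ ^ 2 - (T - δ) ^ 2 * m ^ 2)
      (nhdsWithin 0 (Ioi 0)) (nhds (‖x - z‖ ^ 2 + T ^ 2 * ‖q‖ ^ 2 - T ^ 2 * m ^ 2)) := by
    have h0 : Tendsto γ (nhdsWithin 0 (Ioi 0)) (nhds x) := by
      have := (hγ.2.1 0 self_mem_Ici).tendsto.mono_left (nhdsWithin_mono 0 Ioi_subset_Ici_self)
      rwa [hγ.1] at this
    have h1 : Tendsto (fun δ : ℝ => (T - δ) ^ 2) (nhdsWithin 0 (Ioi 0)) (nhds (T ^ 2)) := by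
      have : Tendsto (fun δ : ℝ => (T - δ) ^ 2) (nhds 0) (nhds ((T - 0) ^ 2)) :=
        Continuous.tendsto (by fun_prop) 0
      rw [sub_zero] at this
      exact this.mono_left nhdsWithin_le_nhds
    exact ((((h0.sub_const z).norm.pow 2).add (h1.mul_const _))).sub (h1.mul_const _)
  have hev := (hcont.eventually_lt_const (sub_neg.2 hcon)).and (Ioo_mem_nhdsGT hT)
  obtain ⟨ε, hε, hsubset⟩ := mem_nhdsGT_iff_exists_Ioo_subset.1 hev
  obtain ⟨δ, hδ, hgood⟩ := exists_mem_Ioo_of_ae hae hε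
  obtain ⟨hneg, hδT⟩ := hsubset hδ
  have := key δ hδ.1 hδT.2 ⟨_, (hgood hδ.1).2⟩
  linarith

/-- **Uniform convergence of minimal-norm subgradients along a segment of initial
conditions.** Let `f : H → ℝ ∪ {+∞}` be proper lsc convex, `x, y ∈ dom f`, and for
`λ ∈ [0,1]` let `w λ` be the subgradient curve of `f` emanating from `λ•x + (1-λ)•y`.
Then `sup_{λ ∈ [0,1]} ‖∂°f(w λ t)‖ → ‖pf‖` as `t → ∞`, where `pf` is the Crandall–Pazy
direction of `f` (the element of minimal norm of the closure of the range of `∂f`). -/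
theorem sup_minNorm_subgradient_tendsto_CP_norm
    (f : H → EReal)
    (hproper : ∃ y, f y ≠ ⊤) (hnobot : ∀ y, f y ≠ ⊥)
    (hlsc : LowerSemicontinuous f) (hconv : ConvexE f)
    (x y : H) (hx : f x ≠ ⊤) (hy : f y ≠ ⊤)
    (pf : H)
    (hpf : pf ∈ closure (⋃ z, SubdiffE f z) ∧
      ∀ q ∈ closure (⋃ z, SubdiffE f z), ‖pf‖ ≤ ‖q‖)
    (w : ℝ → ℝ → H)
    (hw : ∀ lam ∈ Set.Icc (0:ℝ) 1,
      IsSubgradientCurve f (lam • x + (1 - lam) • y) (w lam)) :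
    Filter.Tendsto
      (fun t : ℝ => ⨆ lam ∈ Set.Icc (0:ℝ) 1,
        (‖minNormElt (SubdiffE f (w lam t))‖₊ : ℝ≥0∞))
      Filter.atTop (nhds ((‖pf‖₊ : ℝ≥0∞))) := by
  refine tendsto_order.2 ⟨fun a ha => ?_, fun a ha => ?_⟩
  · filter_upwards [eventually_gt_atTop 0] with t ht
    have hmem : (0 : ℝ) ∈ Icc (0 : ℝ) 1 := ⟨le_rfl, zero_le_one⟩
    have hle : ‖pf‖ ≤ ‖minNormElt (SubdiffE f (w 0 t))‖ :=
      hpf.2 _ (subset_closure (mem_iUnion.2 ⟨_, (minNormElt_spec hlsc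
        ((hw 0 hmem).subdiffE_nonempty hproper hnobot hlsc ht)).1⟩))
    exact ha.trans_le (le_iSup₂_of_le 0 hmem (ENNReal.coe_le_coe.2 hle))
  · obtain ⟨c, hpc, hca⟩ := ENNReal.lt_iff_exists_nnreal_btwn.1 ha
    have hpc' : ‖pf‖ < c := ENNReal.coe_lt_coe.1 hpc
    obtain ⟨q, hqc, hq⟩ := mem_closure_iff.1 hpf.1 _
      (isOpen_lt continuous_norm continuous_const) hpc'
    obtain ⟨z, hz⟩ := mem_iUnion.1 hq
    set R := ‖x - z‖ + ‖y - z‖ with hR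
    have hgap : 0 < (c : ℝ) ^ 2 - ‖q‖ ^ 2 :=
      sub_pos.2 (pow_lt_pow_left₀ hqc (norm_nonneg _) two_ne_zero)
    have hlarge : ∀ᶠ t : ℝ in atTop, R ^ 2 ≤ t ^ 2 * ((c : ℝ) ^ 2 - ‖q‖ ^ 2) :=
      ((tendsto_pow_atTop two_ne_zero).atTop_mul_const hgap).eventually_ge_atTop _
    filter_upwards [eventually_gt_atTop 0, hlarge] with t ht hRt
    refine (iSup₂_le fun lam hlam => ENNReal.coe_le_coe.2 ?_).trans_lt hca
    have hest := (hw lam hlam).sq_mul_norm_minNormElt_sq_le hproper hnobot hlsc hz ht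
    have hdist : ‖lam • x + (1 - lam) • y - z‖ ≤ R := by
      have hsplit : lam • x + (1 - lam) • y - z = lam • (x - z) + (1 - lam) • (y - z) := by
        module
      rw [hsplit]
      refine (norm_add_le _ _).trans ?_
      rw [norm_smul, norm_smul, Real.norm_of_nonneg hlam.1,
        Real.norm_of_nonneg (sub_nonneg.2 hlam.2)]
      exact add_le_add (mul_le_of_le_one_left (norm_nonneg _) hlam.2)
        (mul_le_of_le_one_left (norm_nonneg _) (sub_le_self _ hlam.1))
    have hdist2 := pow_le_pow_left₀ (norm_nonneg _) hdist 2
    have hsq : ‖minNormElt (SubdiffE f (w lam t))‖ ^ 2 ≤ (c : ℝ) ^ 2 :=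
      le_of_mul_le_mul_left (by linarith) (pow_pos ht 2)
    exact NNReal.coe_le_coe.1 (le_of_sq_le_sq hsq c.coe_nonneg)
end
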